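/- arXiv:1710.10964 — 3 statements merged into one kernel-verified Lean document; each statement's English description precedes it below -/
import Mathlib

section
/- Let S be a string of length at least k ≥ 1 and let Γ be a k-attractor of S. Then |Γ| ≥ σ_k(S)/k, where σ_k(S) is the number of distinct substrings of S of length k; equivalently, γ_k*(S) ≥ ⌈σ_k(S)/k⌉. -/
universe u

variable {α : Type*}

/-- `substr T i j` is the 1-based substring `T[i..j]` of `T`. -/
def substr (T : List α) (i j : ℕ) : List α := (T.drop (i - 1)).take (j + 1 - i)

/-- `Γ` is a string attractor of `T` (positions are 1-based): every nonempty
substring `T[i..j]` has an occurrence `T[i'..j'] = T[i..j]` crossing a position of `Γ`. -/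
def IsAttractor (T : List α) (Γ : Finset ℕ) : Prop :=
  (∀ p ∈ Γ, 1 ≤ p ∧ p ≤ T.length) ∧
  ∀ i j : ℕ, 1 ≤ i → i ≤ j → j ≤ T.length →
    ∃ i' j' p : ℕ, 1 ≤ i' ∧ i' ≤ j' ∧ j' ≤ T.length ∧
      substr T i' j' = substr T i j ∧ p ∈ Γ ∧ i' ≤ p ∧ p ≤ j'

/-- `Γ` is a `k`-attractor of `T`: every nonempty substring `T[i..j]` with
`j - i + 1 ≤ k` has an occurrence crossing a position of `Γ`. -/
def IsKAttractor (k : ℕ) (T : List α) (Γ : Finset ℕ) : Prop :=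
  (∀ p ∈ Γ, 1 ≤ p ∧ p ≤ T.length) ∧
  ∀ i j : ℕ, 1 ≤ i → i ≤ j → j ≤ T.length → j + 1 ≤ i + k →
    ∃ i' j' p : ℕ, 1 ≤ i' ∧ i' ≤ j' ∧ j' ≤ T.length ∧
      substr T i' j' = substr T i j ∧ p ∈ Γ ∧ i' ≤ p ∧ p ≤ j'

/-- `minKAttr k T` is the minimum size `γ_k*(T)` of a `k`-attractor of `T`. -/
noncomputable def minKAttr (k : ℕ) (T : List α) : ℕ :=
  sInf {m | ∃ Γ : Finset ℕ, IsKAttractor k T Γ ∧ Γ.card = m}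

/-- `sigmaK k S` is the number of distinct substrings of `S` of length `k`. -/
noncomputable def sigmaK (k : ℕ) (S : List α) : ℕ :=
  {W : List α | W.length = k ∧ W <:+: S}.ncard

theorem sigmaK_le_aux (S : List α) (k : ℕ) (hk : 1 ≤ k)
    (Γ : Finset ℕ) (hΓ : IsKAttractor k S Γ) : sigmaK k S ≤ Γ.card * k := by
  classical
  have hsub : {W : List α | W.length = k ∧ W <:+: S} ⊆
      (((Γ ×ˢ Finset.range k).image
        (fun q : ℕ × ℕ => (S.drop (q.1 - 1 - q.2)).take k) : Finset (List α)) : Set (List α)) := by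
    rintro W ⟨hW, a, b, hab⟩
    have hlen : S.length = a.length + k + b.length := by
      rw [← hab, ← hW]; simp only [List.length_append]
    have hWs : substr S (a.length + 1) (a.length + k) = W := by
      have h1 : a.length + k + 1 - (a.length + 1) = W.length := by omega
      unfold substr
      rw [h1, ← hab]
      simp
    obtain ⟨i', j', p, h1, h2, h3, h4, hp, h5, h6⟩ :=
      hΓ.2 (a.length + 1) (a.length + k) (by omega) (by omega) (by omega) (by omega)
    rw [hWs] at h4
    have h7 : (substr S i' j').length = k := by rw [h4, hW]
    have h8 : j' + 1 - i' = k := by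
      unfold substr at h7
      rw [List.length_take, List.length_drop] at h7
      omega
    rw [Finset.mem_coe, Finset.mem_image]
    refine ⟨(p, p - i'), ?_, ?_⟩
    · rw [Finset.mem_product, Finset.mem_range]
      exact ⟨hp, by dsimp only; omega⟩
    · have h9 : p - 1 - (p - i') = i' - 1 := by omega
      dsimp only
      rw [h9, ← h4, substr, h8]
  unfold sigmaK
  calc _ ≤ _ := Set.ncard_le_ncard hsub (Finset.finite_toSet _)
    _ = _ := Set.ncard_coe_finset _
    _ ≤ _ := Finset.card_image_le
    _ = _ := by rw [Finset.card_product, Finset.card_range]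

/-- a `k`-attractor `Γ` of a string `S` of length at least `k`
satisfies `|Γ| ≥ σ_k(S)/k`; equivalently `γ_k*(S) ≥ ⌈σ_k(S)/k⌉`. -/
theorem kattractor_lower_bound (S : List α) (k : ℕ) (hk : 1 ≤ k) (hkS : k ≤ S.length)
    (Γ : Finset ℕ) (hΓ : IsKAttractor k S Γ) :
    (sigmaK k S : ℝ) / (k : ℝ) ≤ (Γ.card : ℝ) ∧
    ⌈(sigmaK k S : ℝ) / (k : ℝ)⌉₊ ≤ minKAttr k S := by
  have key : ∀ Δ : Finset ℕ, IsKAttractor k S Δ →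
      (sigmaK k S : ℝ) / (k : ℝ) ≤ (Δ.card : ℝ) := by
    intro Δ hΔ
    have hk0 : (0 : ℝ) < k := by exact_mod_cast hk
    rw [div_le_iff₀ hk0]
    exact_mod_cast sigmaK_le_aux S k hk Δ hΔ
  refine ⟨key Γ hΓ, ?_⟩
  have hne : {m | ∃ Δ : Finset ℕ, IsKAttractor k S Δ ∧ Δ.card = m}.Nonempty := ⟨_, Γ, hΓ, rfl⟩
  obtain ⟨Δ, hΔ, hc⟩ := Nat.sInf_mem hne
  unfold minKAttr
  rw [← hc]
  exact Nat.ceil_le.mpr (key Δ hΔ)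
end

section
/- Let T be a string of length n with n ≥ k ≥ 1, and let γ_k*(T) be the minimum size of a k-attractor of T. Then γ_k*(T) ≤ σ_k(T²) ≤ 2k·γ_k*(T), where T² is the concatenation of two copies of T and σ_k(T²) is the number of distinct substrings of T² of length k. -/
universe u

variable {α : Type*}

def win (T : List α) (k i : ℕ) : List α := ((T ++ T).drop i).take k

theorem win_mem (T : List α) (k i : ℕ) (h : i + k ≤ T.length + T.length) :
    win T k i ∈ {W : List α | W.length = k ∧ W <:+: T ++ T} := by
  refine ⟨?_, ?_⟩
  · simp only [win, List.length_take, List.length_drop, List.length_append]; omega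
  · exact (List.take_prefix _ _).isInfix.trans (List.drop_suffix _ _).isInfix

theorem mem_win (T : List α) (k : ℕ) (W : List α)
    (h : W ∈ {W : List α | W.length = k ∧ W <:+: T ++ T}) :
    ∃ a, a + k ≤ T.length + T.length ∧ W = win T k a := by
  obtain ⟨hl, s, t, hst⟩ := h
  refine ⟨s.length, ?_, ?_⟩
  · have := congrArg List.length hst
    simp only [List.length_append] at this
    omega
  · unfold win
    rw [← hst, ← hl]
    simp

theorem win_finite (T : List α) (k : ℕ) :
    {W : List α | W.length = k ∧ W <:+: T ++ T}.Finite := by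
  refine ((Set.finite_Iic (T.length + T.length)).image (win T k)).subset ?_
  intro W hW
  obtain ⟨a, ha, rfl⟩ := mem_win T k W hW
  exact ⟨a, by simp only [Set.mem_Iic]; omega, rfl⟩

theorem take_win (T : List α) (k i l : ℕ) (hl : l ≤ k) (h : i + l ≤ T.length) :
    (win T k i).take l = (T.drop i).take l := by
  unfold win
  rw [List.take_take, min_eq_left hl, List.drop_append_of_le_length (by omega),
    List.take_append_of_le_length (by simp only [List.length_drop]; omega)]

theorem exists_attr (T : List α) (k : ℕ) (hkn : k ≤ T.length) :
    ∃ Γ : Finset ℕ, IsKAttractor k T Γ ∧ Γ.card ≤ sigmaK k (T ++ T) := by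
  classical
  let G : Finset ℕ := (Finset.range T.length).filter (fun i => ∀ j < i, win T k j ≠ win T k i)
  refine ⟨G.image (· + 1), ⟨?_, ?_⟩, ?_⟩
  · intro p hp
    obtain ⟨a, ha, rfl⟩ := Finset.mem_image.1 hp
    have := Finset.mem_range.1 (Finset.mem_filter.1 ha).1
    omega
  · intro i j hi hij hj hk
    have hex : ∃ a, win T k a = win T k (i - 1) := ⟨_, rfl⟩
    have h1 := Nat.find_spec hex
    have h2 : Nat.find hex ≤ i - 1 := Nat.find_min' hex rfl
    have h3 : ∀ b < Nat.find hex, win T k b ≠ win T k (i - 1) := fun b hb => Nat.find_min hex hb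
    generalize Nat.find hex = a at h1 h2 h3
    refine ⟨a + 1, a + (j + 1 - i), a + 1, by omega, by omega, by omega, ?_, ?_, by omega, by omega⟩
    · unfold substr
      have e : a + (j + 1 - i) + 1 - (a + 1) = j + 1 - i := by omega
      rw [e, Nat.add_sub_cancel, ← take_win T k a _ (by omega) (by omega), h1,
        take_win T k (i - 1) _ (by omega) (by omega)]
    · refine Finset.mem_image.2 ⟨a, Finset.mem_filter.2 ⟨Finset.mem_range.2 (by omega), ?_⟩, rfl⟩
      intro b hb
      rw [h1]
      exact h3 b hb
  · refine Finset.card_image_le.trans ?_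
    unfold sigmaK
    rw [← Set.ncard_coe_finset]
    refine Set.ncard_le_ncard_of_injOn (win T k) ?_ ?_ (win_finite T k)
    · intro a ha
      have := Finset.mem_range.1 (Finset.mem_filter.1 ha).1
      exact win_mem T k a (by omega)
    · intro a ha b hb hab
      have ha' := (Finset.mem_filter.1 ha).2
      have hb' := (Finset.mem_filter.1 hb).2
      rcases lt_trichotomy a b with h | h | h
      · exact absurd hab (hb' a h)
      · exact h
      · exact absurd hab.symm (ha' b h)

theorem sigma_le (T : List α) (k : ℕ) (hk : 1 ≤ k) (hkn : k ≤ T.length) (Γ : Finset ℕ)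
    (h : IsKAttractor k T Γ) : sigmaK k (T ++ T) ≤ 2 * k * Γ.card := by
  classical
  obtain ⟨-, h⟩ := h
  have hpos : 1 ≤ Γ.card := by
    obtain ⟨_, _, p, _, _, _, _, hp, _⟩ := h 1 1 le_rfl le_rfl (by omega) (by omega)
    exact Finset.card_pos.2 ⟨p, hp⟩
  let A : Finset (List α) := (Γ ×ˢ Finset.range k).image
    (fun q => (T.drop (q.1 - 1 - q.2)).take k)
  let B : Finset (List α) := (Finset.range (k - 1)).image
    (fun d => win T k (T.length - k + 1 + d))
  have hA : A.card ≤ Γ.card * k := by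
    refine Finset.card_image_le.trans ?_
    rw [Finset.card_product, Finset.card_range]
  have hB : B.card ≤ k - 1 := by
    refine Finset.card_image_le.trans ?_
    rw [Finset.card_range]
  have key : ∀ a, a + k ≤ T.length → (T.drop a).take k ∈ A := by
    intro a ha
    obtain ⟨i, j, p, hi, hij, hj, he, hp, hip, hpj⟩ :=
      h (a + 1) (a + k) (by omega) (by omega) (by omega) (by omega)
    unfold substr at he
    have e : a + k + 1 - (a + 1) = k := by omega
    rw [e, Nat.add_sub_cancel] at he
    have hl := congrArg List.length he
    simp only [List.length_take, List.length_drop] at hl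
    have hl' : j + 1 - i = k := by omega
    rw [hl'] at he
    refine Finset.mem_image.2 ⟨(p, p - i), Finset.mem_product.2
      ⟨hp, Finset.mem_range.2 (by simp only; omega)⟩, ?_⟩
    have e2 : p - 1 - (p - i) = i - 1 := by omega
    simp only [e2]
    exact he
  have hsub : {W : List α | W.length = k ∧ W <:+: T ++ T} ⊆ ((A ∪ B : Finset (List α)) : Set (List α)) := by
    intro W hW
    obtain ⟨a, ha, rfl⟩ := mem_win T k W hW
    rw [Finset.mem_coe, Finset.mem_union]
    by_cases h1 : a + k ≤ T.length
    · left
      have := take_win T k a k le_rfl h1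
      have e : (win T k a).take k = win T k a := by
        unfold win; rw [List.take_take, min_self]
      rw [← e, this]
      exact key a h1
    · by_cases h2 : a < T.length
      · right
        refine Finset.mem_image.2 ⟨a + k - T.length - 1, Finset.mem_range.2 (by omega), ?_⟩
        have e : T.length - k + 1 + (a + k - T.length - 1) = a := by omega
        simp only [e]
      · left
        have e : win T k a = (T.drop (a - T.length)).take k := by
          unfold win
          rw [List.drop_append, List.drop_eq_nil_of_le (by omega), List.nil_append]
        rw [e]
        exact key _ (by omega)
  have hc := Set.ncard_le_ncard hsub (Finset.finite_toSet _)
  rw [Set.ncard_coe_finset] at hc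
  have hu := Finset.card_union_le A B
  have hkk : k ≤ k * Γ.card := Nat.le_mul_of_pos_right _ hpos
  have : 2 * k * Γ.card = Γ.card * k + k * Γ.card := by ring
  unfold sigmaK
  omega

/-- for `1 ≤ k ≤ n = |T|`,
`γ_k*(T) ≤ σ_k(T²) ≤ 2k · γ_k*(T)`. -/
theorem sigma_approximates_kattractor (T : List α) (k : ℕ) (hk : 1 ≤ k)
    (hkn : k ≤ T.length) :
    minKAttr k T ≤ sigmaK k (T ++ T) ∧ sigmaK k (T ++ T) ≤ 2 * k * minKAttr k T := by
  obtain ⟨Γ, h1, h2⟩ := exists_attr T k hkn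
  have h3 : minKAttr k T ≤ Γ.card := Nat.sInf_le ⟨Γ, h1, rfl⟩
  refine ⟨h3.trans h2, ?_⟩
  obtain ⟨G, hG, hc⟩ := Nat.sInf_mem
    (s := {m | ∃ Γ : Finset ℕ, IsKAttractor k T Γ ∧ Γ.card = m}) ⟨_, Γ, h1, rfl⟩
  unfold minKAttr
  rw [← hc]
  exact sigma_le T k hk hkn G hG
end

section
/- If a string T is generated by a straight-line program (SLP) of size g, then T has a string attractor of size at most g. -/
universe u

variable {α : Type*}

/-- A rule of a collage system whose nonterminals are `Fin c`. -/
inductive CRule (α : Type u) (c : ℕ) where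
  | term (a : α)
  | cat (A B : Fin c)
  | rep (R : Fin c) (ℓ : ℕ)
  | slice (K : Fin c) (l r : ℕ)

/-- Validity of the rule of nonterminal `X` with respect to the expansions `exp`;
`rank` is a topological rank witnessing that the derivation relation has no cycles. -/
def CRuleOk {c : ℕ} (rule : Fin c → CRule α c) (exp : Fin c → List α)
    (rank : Fin c → ℕ) (X : Fin c) : Prop :=
  match rule X with
  | .term a => exp X = [a]
  | .cat A B => A ≠ X ∧ B ≠ X ∧ rank A < rank X ∧ rank B < rank X ∧
      exp X = exp A ++ exp B
  | .rep R ℓ => 2 ≤ ℓ ∧ R ≠ X ∧ rank R < rank X ∧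
      exp X = (List.replicate ℓ (exp R)).flatten
  | .slice K l r => K ≠ X ∧ rank K < rank X ∧ 1 ≤ l ∧ l ≤ r ∧ r ≤ (exp K).length ∧
      exp X = substr (exp K) l r

/-- `(rule, exp, rank)` is a valid collage system (one rule per nonterminal, no cycles). -/
def IsCollage {c : ℕ} (rule : Fin c → CRule α c) (exp : Fin c → List α)
    (rank : Fin c → ℕ) : Prop := ∀ X, CRuleOk rule exp rank X

/-- `T` is generated by some collage system of size `c`. -/
def GeneratedByCollage (T : List α) (c : ℕ) : Prop :=
  ∃ (rule : Fin c → CRule α c) (exp : Fin c → List α) (rank : Fin c → ℕ) (S : Fin c),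
    IsCollage rule exp rank ∧ exp S = T

/-- An SLP rule: only the forms `X → a` and `X → AB` are allowed. -/
def CRule.IsSLPRule {c : ℕ} : CRule α c → Prop
  | .term _ => True
  | .cat _ _ => True
  | _ => False

/-- `T` is generated by some straight-line program of size `g`. -/
def GeneratedBySLP (T : List α) (g : ℕ) : Prop :=
  ∃ (rule : Fin g → CRule α g) (exp : Fin g → List α) (rank : Fin g → ℕ) (S : Fin g),
    IsCollage rule exp rank ∧ (∀ X, (rule X).IsSLPRule) ∧ exp S = T

theorem slp_exp_ne_nil {g : ℕ} (rule : Fin g → CRule α g) (exp : Fin g → List α)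
    (rank : Fin g → ℕ) (hc : IsCollage rule exp rank) (hs : ∀ X, (rule X).IsSLPRule) :
    ∀ n X, rank X = n → exp X ≠ [] := by
  intro n
  induction n using Nat.strong_induction_on with
  | _ n ih =>
    intro X hX
    have h1 := hc X
    have h2 := hs X
    unfold CRuleOk at h1
    cases hr : rule X with
    | term a => simp only [hr] at h1; simp [h1]
    | cat A B =>
      simp only [hr] at h1
      obtain ⟨_, _, hA, hB, he⟩ := h1
      have := ih _ (hX ▸ hA) A rfl
      simp [he, this]
    | rep R l => simp [hr, CRule.IsSLPRule] at h2
    | slice K l r => simp [hr, CRule.IsSLPRule] at h2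

theorem slp_infix_append {w A B : List α} (h : w <:+: A ++ B) :
    w <:+: A ∨ w <:+: B ∨ ∃ a s t b, w = s ++ t ∧ s ≠ [] ∧ t ≠ [] ∧ A = a ++ s ∧ B = t ++ b := by
  obtain ⟨a, b, h⟩ := h
  rw [List.append_assoc] at h
  rcases List.append_eq_append_iff.1 h with ⟨c, hA, hB⟩ | ⟨c, ha, hB⟩
  · rcases List.append_eq_append_iff.1 hB with ⟨d, h1, h2⟩ | ⟨d, h1, h2⟩
    · exact Or.inl ⟨a, d, by simp [hA, h1]⟩
    · by_cases hc : c = []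
      · right; left
        exact ⟨[], b, by simp [h1, h2, hc]⟩
      · by_cases hd : d = []
        · left
          exact ⟨a, [], by simp [h1, hA, hd]⟩
        · exact Or.inr (Or.inr ⟨a, c, d, b, h1, hc, hd, hA, h2⟩)
  · exact Or.inr (Or.inl ⟨c, b, by simp [hB]⟩)

/-- if `T` is generated by a straight-line program of size `g`,
then `T` has a string attractor of size at most `g`. -/
theorem slp_attractor (T : List α) (g : ℕ) (h : GeneratedBySLP T g) :
    ∃ Γ : Finset ℕ, IsAttractor T Γ ∧ Γ.card ≤ g := by
  obtain ⟨rule, exp, rank, S, hc, hs, hT⟩ := h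
  have hne : ∀ X, exp X ≠ [] := fun X => slp_exp_ne_nil rule exp rank hc hs _ X rfl
  have hpos : ∀ X, 1 ≤ (exp X).length := fun X => List.length_pos_iff.2 (hne X)
  have key : ∀ X, ∃ q, (1 ≤ q ∧ q ≤ T.length) ∧ (exp X <:+: T → ∀ w, w ≠ [] → w <:+: exp X →
      (∃ a b, T = a ++ (w ++ b) ∧ a.length < q ∧ q ≤ a.length + w.length) ∨
      ∃ Y, rank Y < rank X ∧ exp Y <:+: T ∧ w <:+: exp Y) := by
    intro X
    by_cases hX : exp X <:+: T
    swap
    · exact ⟨1, ⟨le_rfl, hT ▸ hpos S⟩, fun h => absurd h hX⟩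
    obtain ⟨u, v, huv⟩ := id hX
    have h1 := hc X
    have h2 := hs X
    unfold CRuleOk at h1
    cases hr : rule X with
    | term a =>
      simp only [hr] at h1
      refine ⟨u.length + 1, ⟨by omega, by simp [← huv, h1]⟩, fun _ w hw hwi => Or.inl ?_⟩
      have hl := List.length_pos_iff.2 hw
      have : w = exp X := hwi.eq_of_length_le (by rw [h1]; exact hl)
      exact ⟨u, v, by simp [← huv, this], by omega, by omega⟩
    | cat A B =>
      simp only [hr] at h1
      obtain ⟨_, _, hA, hB, he⟩ := h1
      have hpA := hpos A
      refine ⟨u.length + (exp A).length, ⟨by omega, by simp [← huv, he]⟩, fun _ w hw hwi => ?_⟩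
      rw [he] at hwi
      rcases slp_infix_append hwi with h | h | ⟨a, s, t, b, rfl, hs', ht', h3, h4⟩
      · exact Or.inr ⟨A, hA, ⟨u, exp B ++ v, by simp [← huv, he]⟩, h⟩
      · exact Or.inr ⟨B, hB, ⟨u ++ exp A, v, by simp [← huv, he]⟩, h⟩
      · have := List.length_pos_iff.2 hs'
        exact Or.inl ⟨u ++ a, b ++ v, by simp [← huv, he, h3, h4], by simp [h3]; omega,
          by simp [h3]; omega⟩
    | rep R l => simp [hr, CRule.IsSLPRule] at h2
    | slice K l r => simp [hr, CRule.IsSLPRule] at h2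
  choose q hq hk using key
  have main : ∀ n X, rank X = n → exp X <:+: T → ∀ w, w ≠ [] → w <:+: exp X →
      ∃ a b Y, T = a ++ (w ++ b) ∧ a.length < q Y ∧ q Y ≤ a.length + w.length := by
    intro n
    induction n using Nat.strong_induction_on with
    | _ n ih =>
      intro X hX hXT w hw hwX
      rcases hk X hXT w hw hwX with ⟨a, b, h⟩ | ⟨Y, h1, h2, h3⟩
      · exact ⟨a, b, X, h⟩
      · exact ih _ (hX ▸ h1) Y rfl h2 w hw h3
  refine ⟨Finset.univ.image q, ⟨?_, ?_⟩, ?_⟩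
  · intro p hp
    obtain ⟨X, _, rfl⟩ := Finset.mem_image.1 hp
    exact hq X
  · intro i j hi hij hj
    have hlen : (substr T i j).length = j + 1 - i := by
      simp [substr]; omega
    have hw : substr T i j ≠ [] := by
      rw [← List.length_pos_iff]; omega
    have hinf : substr T i j <:+: T :=
      (List.take_prefix _ _).isInfix.trans (List.drop_suffix _ _).isInfix
    obtain ⟨a, b, Y, h1, h2, h3⟩ := main _ S rfl (by rw [hT]) _ hw (by rw [hT]; exact hinf)
    have hTl := congrArg List.length h1
    simp only [List.length_append, hlen] at hTl
    refine ⟨a.length + 1, a.length + (j + 1 - i), q Y, by omega, by omega, by omega, ?_,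
      by simp, by omega, by omega⟩
    generalize substr T i j = w at *
    subst h1
    have e : a.length + (j + 1 - i) + 1 - (a.length + 1) = w.length := by omega
    unfold substr
    rw [e]
    simp
  · exact Finset.card_image_le.trans (by simp)
end
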